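/- For every infinite bit sequence A, if Γ(A) < 1/2 then Γ(A) = 0. -/

import Mathlib

open Filter

namespace Paper

/-! ### Oracle computability -/

/-- Codes for oracle Turing functionals (partial recursive operators with one
function oracle), following the pattern of `Nat.Partrec.Code`. -/
inductive OracleCode : Type
  | zero
  | succ
  | left
  | right
  | oracle
  | pair : OracleCode → OracleCode → OracleCode
  | comp : OracleCode → OracleCode → OracleCode
  | prec : OracleCode → OracleCode → OracleCode
  | rfind' : OracleCode → OracleCode

/-- Evaluation of an oracle code with oracle `g : ℕ → ℕ`. -/
def OracleCode.eval (g : ℕ → ℕ) : OracleCode → ℕ →. ℕ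
  | .zero => pure 0
  | .succ => Nat.succ
  | .left => ↑fun n : ℕ => n.unpair.1
  | .right => ↑fun n : ℕ => n.unpair.2
  | .oracle => ↑fun n : ℕ => g n
  | .pair cf cg => fun n => Nat.pair <$> eval g cf n <*> eval g cg n
  | .comp cf cg => fun n => eval g cg n >>= eval g cf
  | .prec cf cg =>
    Nat.unpaired fun a n =>
      n.rec (eval g cf a) fun y IH => do
        let i ← IH
        eval g cg (Nat.pair a (Nat.pair y i))
  | .rfind' cf =>
    Nat.unpaired fun a m =>
      (Nat.rfind fun n => (fun m => m = 0) <$> eval g cf (Nat.pair a (n + m))).map (· + m)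

/-- Turing reducibility: `f ≤_T g` iff some oracle functional with oracle `g`
computes `f` (totally). -/
def TuringLE (f g : ℕ → ℕ) : Prop :=
  ∃ c : OracleCode, ∀ n, OracleCode.eval g c n = Part.some (f n)

/-- Turing equivalence. -/
def TuringEquiv (f g : ℕ → ℕ) : Prop := TuringLE f g ∧ TuringLE g f

/-- A mass problem is a set of functions `ℕ → ℕ`. -/
abbrev MassProblem := Set (ℕ → ℕ)

/-- Muchnik (weak) reducibility `B ≤_W C`. -/
def MuchnikLE (B C : MassProblem) : Prop := ∀ g ∈ C, ∃ f ∈ B, TuringLE f g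

/-- Muchnik equivalence. -/
def MuchnikEquiv (B C : MassProblem) : Prop := MuchnikLE B C ∧ MuchnikLE C B

/-- Medvedev (strong) reducibility `B ≤_S C`: a single Turing functional is
defined on all of `C` and maps each member of `C` to a member of `B`. -/
def MedvedevLE (B C : MassProblem) : Prop :=
  ∃ c : OracleCode, ∀ g ∈ C, ∃ f ∈ B, ∀ n, OracleCode.eval g c n = Part.some (f n)

/-- Medvedev equivalence. -/
def MedvedevEquiv (B C : MassProblem) : Prop := MedvedevLE B C ∧ MedvedevLE C B

/-! ### Density notions -/

/-- Lower (asymptotic) density of a set of naturals. -/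
noncomputable def lowerDensity (z : Set ℕ) : ℝ :=
  Filter.liminf (fun n => (Nat.card ↥(z ∩ Set.Iio n) : ℝ) / n) Filter.atTop

/-- `x ↔ y`: the agreement set of two functions. -/
def agree (x y : ℕ → ℕ) : Set ℕ := {n | x n = y n}

/-- A bit sequence is a `{0,1}`-valued function. -/
def IsBitSeq (x : ℕ → ℕ) : Prop := ∀ n, x n < 2

/-- The mass problem `D(p)`. -/
def probD (p : ℝ) : MassProblem :=
  {y | IsBitSeq y ∧ ∀ x : ℕ → ℕ, IsBitSeq x → Computable x →
    lowerDensity (agree x y) ≤ p}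

/-- The mass problem `B(p)`. -/
def probB (p : ℝ) : MassProblem :=
  {y | IsBitSeq y ∧ ∀ x : ℕ → ℕ, IsBitSeq x → Computable x →
    p < lowerDensity (agree x y)}

/-- The mass problem `IOE(h)`. -/
def IOE (h : ℕ → ℕ) : MassProblem :=
  {f | ∀ x : ℕ → ℕ, Computable x → (∀ n, x n < h n) → ∃ᶠ n in atTop, f n = x n}

/-- The mass problem `AED(h)`. -/
def AED (h : ℕ → ℕ) : MassProblem :=
  {f | (∀ n, f n < h n) ∧ ∀ x : ℕ → ℕ, Computable x → ∀ᶠ n in atTop, f n ≠ x n}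

/-! ### Hamming distance and the problems `D⟨≠*,ĥ,q⟩`, `B⟨≠*,ĥ,q⟩` -/

/-- Normalized Hamming distance between `a` and `b`, viewed as binary strings
of length `r` (via binary expansion with leading zeros). -/
noncomputable def nhd (r a b : ℕ) : ℝ :=
  (((Finset.range r).filter fun i => a.testBit i ≠ b.testBit i).card : ℝ) / r

/-- The mass problem `D⟨≠*, ĥ, q⟩`. -/
def probDneq (hh : ℕ → ℕ) (q : ℝ) : MassProblem :=
  {y | (∀ n, y n < 2 ^ hh n) ∧ ∀ x : ℕ → ℕ, Computable x → (∀ n, x n < 2 ^ hh n) →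
    ∃ᶠ n in atTop, nhd (hh n) (x n) (y n) < q}

/-- The mass problem `B⟨≠*, ĥ, q⟩`. -/
def probBneq (hh : ℕ → ℕ) (q : ℝ) : MassProblem :=
  {y | (∀ n, y n < 2 ^ hh n) ∧ ∀ x : ℕ → ℕ, Computable x → (∀ n, x n < 2 ^ hh n) →
    ∀ᶠ n in atTop, q ≤ nhd (hh n) (x n) (y n)}

/-! ### Slaloms, coded as functions `ℕ → ℕ` via binary digits -/

/-- `s : ℕ → ℕ`, coding finite sets via binary digits (`i ∈ s(n)` iff the
`i`-th bit of `s n` is set), is an `L`-slalom bounded by `u`. -/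
def IsSlalomCode (u : ℕ → ℕ) (L : ℕ) (s : ℕ → ℕ) : Prop :=
  ∀ n, (∀ i, (s n).testBit i = true → i < u n) ∧
    ((Finset.range (u n)).filter fun i => (s n).testBit i = true).card ≤ L

/-- The mass problem `D⟨∌*, u, L⟩`. -/
def probDSlalom (u : ℕ → ℕ) (L : ℕ) : MassProblem :=
  {s | IsSlalomCode u L s ∧ ∀ y : ℕ → ℕ, Computable y → (∀ n, y n < u n) →
    ∃ᶠ n in atTop, (s n).testBit (y n) = true}

/-- The mass problem `B⟨∌*, u, L⟩`. -/
def probBSlalom (u : ℕ → ℕ) (L : ℕ) : MassProblem :=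
  {y | (∀ n, y n < u n) ∧ ∀ s : ℕ → ℕ, Computable s → IsSlalomCode u L s →
    ∀ᶠ n in atTop, (s n).testBit (y n) = false}

/-! ### Gamma and Delta values -/

/-- `γ(A)`. -/
noncomputable def gammaVal (A : ℕ → ℕ) : ℝ :=
  sSup ((fun x => lowerDensity (agree A x)) '' {x | IsBitSeq x ∧ Computable x})

/-- `Γ(A)`. -/
noncomputable def GammaVal (A : ℕ → ℕ) : ℝ :=
  sInf (gammaVal '' {Y | IsBitSeq Y ∧ TuringEquiv Y A})

/-- `δ(A)`. -/
noncomputable def deltaVal (A : ℕ → ℕ) : ℝ :=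
  sInf ((fun x => lowerDensity (agree A x)) '' {x | IsBitSeq x ∧ Computable x})

/-- `Δ(A)`. -/
noncomputable def DeltaVal (A : ℕ → ℕ) : ℝ :=
  sSup (deltaVal '' {Y | IsBitSeq Y ∧ TuringLE Y A})

/-! ### Cardinal characteristics -/

/-- The cardinal characteristic `𝔡(p)`. -/
noncomputable def dChar (p : ℝ) : Cardinal :=
  sInf {c : Cardinal | ∃ G : Set (ℕ → ℕ), c = Cardinal.mk G ∧ (∀ y ∈ G, IsBitSeq y) ∧
    ∀ x : ℕ → ℕ, IsBitSeq x → ∃ y ∈ G, p < lowerDensity (agree x y)}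

/-- The cardinal characteristic `𝔟(p)`. -/
noncomputable def bChar (p : ℝ) : Cardinal :=
  sInf {c : Cardinal | ∃ F : Set (ℕ → ℕ), c = Cardinal.mk F ∧ (∀ x ∈ F, IsBitSeq x) ∧
    ∀ y : ℕ → ℕ, IsBitSeq y → ∃ x ∈ F, lowerDensity (agree x y) ≤ p}

/-- The cardinal characteristic `𝔡(≠*, h)`. -/
noncomputable def dNeq (h : ℕ → ℕ) : Cardinal :=
  sInf {c : Cardinal | ∃ G : Set (ℕ → ℕ), c = Cardinal.mk G ∧ (∀ y ∈ G, ∀ n, y n < h n) ∧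
    ∀ x : ℕ → ℕ, ∃ y ∈ G, ∀ᶠ n in atTop, x n ≠ y n}

/-- The cardinal characteristic `𝔟(≠*, h)`. -/
noncomputable def bNeq (h : ℕ → ℕ) : Cardinal :=
  sInf {c : Cardinal | ∃ F : Set (ℕ → ℕ), c = Cardinal.mk F ∧
    ∀ y : ℕ → ℕ, (∀ n, y n < h n) → ∃ x ∈ F, ∃ᶠ n in atTop, x n = y n}

/-- The cardinal characteristic `𝔡⟨≠*, ĥ, q⟩`. -/
noncomputable def dHam (hh : ℕ → ℕ) (q : ℝ) : Cardinal :=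
  sInf {c : Cardinal | ∃ G : Set (ℕ → ℕ), c = Cardinal.mk G ∧
    (∀ y ∈ G, ∀ n, y n < 2 ^ hh n) ∧
    ∀ x : ℕ → ℕ, (∀ n, x n < 2 ^ hh n) →
      ∃ y ∈ G, ∀ᶠ n in atTop, q ≤ nhd (hh n) (x n) (y n)}

/-- The cardinal characteristic `𝔟⟨≠*, ĥ, q⟩`. -/
noncomputable def bHam (hh : ℕ → ℕ) (q : ℝ) : Cardinal :=
  sInf {c : Cardinal | ∃ F : Set (ℕ → ℕ), c = Cardinal.mk F ∧
    (∀ x ∈ F, ∀ n, x n < 2 ^ hh n) ∧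
    ∀ y : ℕ → ℕ, (∀ n, y n < 2 ^ hh n) →
      ∃ x ∈ F, ∃ᶠ n in atTop, nhd (hh n) (x n) (y n) < q}

/-- `s : ℕ → Finset ℕ` is an `L`-slalom bounded by `u`. -/
def IsSlalom (u : ℕ → ℕ) (L : ℕ) (s : ℕ → Finset ℕ) : Prop :=
  ∀ n, (∀ i ∈ s n, i < u n) ∧ (s n).card ≤ L

/-- The cardinal characteristic `𝔡⟨∌*, u, L⟩`. -/
noncomputable def dSlalom (u : ℕ → ℕ) (L : ℕ) : Cardinal :=
  sInf {c : Cardinal | ∃ G : Set (ℕ → ℕ), c = Cardinal.mk G ∧ (∀ y ∈ G, ∀ n, y n < u n) ∧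
    ∀ s : ℕ → Finset ℕ, IsSlalom u L s → ∃ y ∈ G, ∀ᶠ n in atTop, y n ∉ s n}

/-- The cardinal characteristic `𝔟⟨∌*, u, L⟩`. -/
noncomputable def bSlalom (u : ℕ → ℕ) (L : ℕ) : Cardinal :=
  sInf {c : Cardinal | ∃ F : Set (ℕ → Finset ℕ), c = Cardinal.mk F ∧
    (∀ s ∈ F, IsSlalom u L s) ∧
    ∀ y : ℕ → ℕ, (∀ n, y n < u n) → ∃ s ∈ F, ∃ᶠ n in atTop, y n ∈ s n}

/-! ### Order functions and list decoding -/

/-- An order function: nondecreasing, unbounded and computable. -/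
def IsOrderFunc (F : ℕ → ℕ) : Prop :=
  Computable F ∧ Monotone F ∧ ∀ b : ℕ, ∃ n, b < F n

/-- The list-decoding property for parameters `q`, `ε`, `L`: for every length `r`
there is a set `C` of `2^⌊εr⌋` binary strings of length `r` (coded as numbers
below `2^r`) such that every string has at most `L` elements of `C` within
normalized Hamming distance `< q`. -/
def ListDecoding (q ε : ℝ) (L : ℕ) : Prop :=
  ∀ r : ℕ, ∃ C : Finset ℕ, (∀ a ∈ C, a < 2 ^ r) ∧ C.card = 2 ^ ⌊ε * r⌋₊ ∧
    ∀ σ < 2 ^ r, (C.filter fun τ => nhd r σ τ < q).card ≤ L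


section comp
variable {α : Type*} [Primcodable α]

theorem c_add {f g : α → ℕ} (hf : Computable f) (hg : Computable g) :
    Computable fun a => f a + g a := Primrec.nat_add.to_comp.comp hf hg
theorem c_mul {f g : α → ℕ} (hf : Computable f) (hg : Computable g) :
    Computable fun a => f a * g a := Primrec.nat_mul.to_comp.comp hf hg
theorem c_sub {f g : α → ℕ} (hf : Computable f) (hg : Computable g) :
    Computable fun a => f a - g a := Primrec.nat_sub.to_comp.comp hf hg
theorem c_div {f g : α → ℕ} (hf : Computable f) (hg : Computable g) :
    Computable fun a => f a / g a := Primrec.nat_div.to_comp.comp hf hg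
theorem c_mod {f g : α → ℕ} (hf : Computable f) (hg : Computable g) :
    Computable fun a => f a % g a := Primrec.nat_mod.to_comp.comp hf hg
theorem c_pair {f g : α → ℕ} (hf : Computable f) (hg : Computable g) :
    Computable fun a => Nat.pair (f a) (g a) := Primrec₂.natPair.to_comp.comp hf hg
theorem c_pow {f g : α → ℕ} (hf : Computable f) (hg : Computable g) :
    Computable fun a => f a ^ g a := by
  have : Primrec₂ ((· ^ ·) : ℕ → ℕ → ℕ) := Primrec₂.unpaired'.1 Nat.Primrec.pow
  exact this.to_comp.comp hf hg
theorem c_ite_eq {f g u v : α → ℕ} (hf : Computable f) (hg : Computable g)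
    (hu : Computable u) (hv : Computable v) :
    Computable fun a => if f a = g a then u a else v a := by
  have h : Primrec fun q : (ℕ × ℕ) × (ℕ × ℕ) => if q.1.1 = q.1.2 then q.2.1 else q.2.2 :=
    Primrec.ite (Primrec.eq.comp (Primrec.fst.comp Primrec.fst) (Primrec.snd.comp Primrec.fst))
      (Primrec.fst.comp Primrec.snd) (Primrec.snd.comp Primrec.snd)
  exact h.to_comp.comp ((hf.pair hg).pair (hu.pair hv))
theorem c_ite_le {f g u v : α → ℕ} (hf : Computable f) (hg : Computable g)
    (hu : Computable u) (hv : Computable v) :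
    Computable fun a => if f a ≤ g a then u a else v a := by
  have h : Primrec fun q : (ℕ × ℕ) × (ℕ × ℕ) => if q.1.1 ≤ q.1.2 then q.2.1 else q.2.2 :=
    Primrec.ite (Primrec.nat_le.comp (Primrec.fst.comp Primrec.fst) (Primrec.snd.comp Primrec.fst))
      (Primrec.fst.comp Primrec.snd) (Primrec.snd.comp Primrec.snd)
  exact h.to_comp.comp ((hf.pair hg).pair (hu.pair hv))
theorem c_sum {f : α → ℕ → ℕ} {g : α → ℕ} (hf : Computable fun p : α × ℕ => f p.1 p.2)
    (hg : Computable g) : Computable fun a => ∑ i ∈ Finset.range (g a), f a i := by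
  have h : Computable₂ fun (a : α) (p : ℕ × ℕ) => p.2 + f a p.1 :=
    c_add (Computable.snd.comp Computable.snd)
      (hf.comp (Computable.fst.pair (Computable.fst.comp Computable.snd)))
  refine (Computable.nat_rec hg (Computable.const 0) h).of_eq fun a => ?_
  induction g a with
  | zero => simp
  | succ n ih => simp only [Finset.sum_range_succ, ih]
theorem c_log {f : α → ℕ} (hf : Computable f) : Computable fun a => Nat.log 2 (f a) := by
  have h : Computable fun n : ℕ => ∑ i ∈ Finset.range n, if 2 ^ (i+1) ≤ n then 1 else 0 := by
    apply c_sum (f := fun n i => if 2 ^ (i+1) ≤ n then 1 else 0) _ Computable.id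
    exact c_ite_le (c_pow (Computable.const 2) (c_add Computable.snd (Computable.const 1)))
      Computable.fst (Computable.const 1) (Computable.const 0)
  refine (h.comp hf).of_eq fun a => ?_
  generalize f a = n
  rcases Nat.eq_zero_or_pos n with rfl | hn
  · simp
  rw [← Finset.card_filter]
  have : Finset.filter (fun i => 2 ^ (i+1) ≤ n) (Finset.range n) = Finset.range (Nat.log 2 n) := by
    ext i
    simp only [Finset.mem_filter, Finset.mem_range]
    rw [← Nat.le_log_iff_pow_le (by norm_num) hn.ne']
    have := Nat.log_lt_self 2 hn.ne'
    omega
  rw [this, Finset.card_range]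

theorem c_family (X : ℕ → ℕ → ℕ) (hX : ∀ i, Computable (X i)) (N : ℕ) :
    Computable fun p : ℕ × ℕ => if N ≤ p.1 then 0 else X p.1 p.2 := by
  induction N with
  | zero => exact (Computable.const 0).of_eq (by simp)
  | succ N ih =>
    refine (c_ite_eq (f := fun p : ℕ × ℕ => p.1) (g := fun _ => N) Computable.fst
      (Computable.const N) ((hX N).comp Computable.snd) ih).of_eq ?_
    rintro ⟨i, n⟩
    dsimp only
    by_cases h : i = N
    · subst h; simp
    · by_cases h' : N ≤ i
      · simp [h, h', show N + 1 ≤ i by omega]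
      · simp [h, h', show ¬ N + 1 ≤ i by omega]
end comp

section oracle

def trCode : Nat.Partrec.Code → OracleCode
  | .zero => .zero
  | .succ => .succ
  | .left => .left
  | .right => .right
  | .pair a b => .pair (trCode a) (trCode b)
  | .comp a b => .comp (trCode a) (trCode b)
  | .prec a b => .prec (trCode a) (trCode b)
  | .rfind' a => .rfind' (trCode a)

theorem trCode_eval (g : ℕ → ℕ) (c : Nat.Partrec.Code) :
    (trCode c).eval g = c.eval := by
  induction c <;> simp_all [trCode, OracleCode.eval, Nat.Partrec.Code.eval] <;> rfl

theorem TuringLE.of_computable {f : ℕ → ℕ} (g : ℕ → ℕ) (hf : Computable f) : TuringLE f g := by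
  obtain ⟨c, hc⟩ := Nat.Partrec.Code.exists_code.1 (Partrec.nat_iff.1 hf)
  exact ⟨trCode c, fun n => by rw [trCode_eval, hc]; rfl⟩

theorem TuringLE.refl' (g : ℕ → ℕ) : TuringLE g g := ⟨.oracle, fun _ => rfl⟩

theorem TuringLE.comp' {f u g : ℕ → ℕ} (hf : TuringLE f g) (hu : TuringLE u g) :
    TuringLE (fun n => f (u n)) g := by
  obtain ⟨c, hc⟩ := hf
  obtain ⟨d, hd⟩ := hu
  refine ⟨.comp c d, fun n => ?_⟩
  change (OracleCode.eval g d n).bind (OracleCode.eval g c) = _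
  rw [hd]
  exact (Part.bind_some _ _).trans (hc _)

theorem TuringLE.pair' {f u g : ℕ → ℕ} (hf : TuringLE f g) (hu : TuringLE u g) :
    TuringLE (fun n => Nat.pair (f n) (u n)) g := by
  obtain ⟨c, hc⟩ := hf
  obtain ⟨d, hd⟩ := hu
  exact ⟨.pair c d, fun n => by simp [OracleCode.eval, hc, hd, Seq.seq]⟩

theorem TuringLE.apply₂ {f u g : ℕ → ℕ} {H : ℕ → ℕ → ℕ}
    (hH : Computable fun p : ℕ × ℕ => H p.1 p.2) (hf : TuringLE f g) (hu : TuringLE u g) :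
    TuringLE (fun n => H (f n) (u n)) g := by
  have h1 : Computable fun n : ℕ => H n.unpair.1 n.unpair.2 :=
    hH.comp Computable.unpair
  have := (TuringLE.of_computable g h1).comp' (hf.pair' hu)
  simpa using this

/-- prefix code -/
def pre (Y : ℕ → ℕ) (N : ℕ) : ℕ := ∑ i ∈ Finset.range N, Y i * 2 ^ i

theorem TuringLE.pre' {Y g : ℕ → ℕ} (h : TuringLE Y g) : TuringLE (pre Y) g := by
  have hy : TuringLE (fun n : ℕ => Y n.unpair.2.unpair.1) g :=
    h.comp' (TuringLE.of_computable g (Computable.fst.comp (Computable.unpair.comp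
      (Computable.snd.comp Computable.unpair))))
  have hs : TuringLE (fun n : ℕ => n.unpair.2.unpair.2 + Y n.unpair.2.unpair.1 * 2 ^ n.unpair.2.unpair.1) g := by
    refine TuringLE.apply₂ (H := fun n y => n.unpair.2.unpair.2 + y * 2 ^ n.unpair.2.unpair.1)
      ?_ (f := fun n => n) (TuringLE.of_computable g Computable.id) hy
    have hu : Computable fun p : ℕ × ℕ => p.1.unpair.2.unpair :=
      Computable.unpair.comp (Computable.snd.comp (Computable.unpair.comp Computable.fst))
    exact c_add (Computable.snd.comp hu) (c_mul Computable.snd (c_pow (Computable.const 2)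
      (Computable.fst.comp hu)))
  obtain ⟨d, hd⟩ := hs
  have : TuringLE (fun n : ℕ => pre Y n.unpair.2) g := by
    refine ⟨.prec .zero d, fun n => ?_⟩
    simp only [OracleCode.eval, Nat.unpaired]
    induction n.unpair.2 with
    | zero => simp [pre]; rfl
    | succ k ih =>
      simp only [ih]
      simp [hd, pre, Finset.sum_range_succ]
  have h2 := this.comp' (TuringLE.of_computable g
    (c_pair (Computable.const 0) Computable.id : Computable fun n : ℕ => Nat.pair 0 (id n)))
  simpa using h2
end oracle

/-- binary digit -/
def dig (u i : ℕ) : ℕ := u / 2 ^ i % 2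

theorem dig_lt (u i : ℕ) : dig u i < 2 := Nat.mod_lt _ (by norm_num)

theorem pre_lt {Y : ℕ → ℕ} (hY : ∀ n, Y n < 2) (N : ℕ) : pre Y N < 2 ^ N := by
  induction N with
  | zero => simp [pre]
  | succ N ih =>
    rw [pre, Finset.sum_range_succ, ← pre, pow_succ]
    have := hY N
    nlinarith [Nat.pos_of_ne_zero (pow_ne_zero N (two_ne_zero (α := ℕ)))]

theorem dig_pre {Y : ℕ → ℕ} (hY : ∀ n, Y n < 2) {N i : ℕ} (hi : i < N) :
    dig (pre Y N) i = Y i := by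
  induction N with
  | zero => omega
  | succ N ih =>
    rw [pre, Finset.sum_range_succ, ← pre]
    rcases Nat.lt_succ_iff_lt_or_eq.1 hi with h | h
    · rw [← ih h, dig, dig]
      obtain ⟨t, rfl⟩ : ∃ t, N = i + 1 + t := ⟨N - (i+1), by omega⟩
      have : pre Y (i+1+t) + Y (i+1+t) * 2 ^ (i+1+t)
        = pre Y (i+1+t) + 2 ^ i * (2 * (Y (i+1+t) * 2^t)) := by ring
      rw [this, Nat.add_mul_div_left _ _ (by positivity), Nat.add_mul_mod_self_left]
    · subst h
      rw [dig, Nat.add_mul_div_right _ _ (by positivity), Nat.div_eq_of_lt (pre_lt hY i)]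
      have := hY i
      omega

theorem c_dig {α : Type*} [Primcodable α] {f g : α → ℕ} (hf : Computable f) (hg : Computable g) :
    Computable fun a => dig (f a) (g a) :=
  c_mod (c_div hf (c_pow (Computable.const 2) hg)) (Computable.const 2)

theorem dig_ext {k c d : ℕ} (hc : c < 2 ^ k) (hd : d < 2 ^ k) (h : ∀ i < k, dig c i = dig d i) :
    c = d := by
  refine Nat.eq_of_testBit_eq fun i => ?_
  by_cases hi : i < k
  · have := h i hi
    simp only [dig] at this
    simp [Nat.testBit, Nat.shiftRight_eq_div_pow, Nat.one_and_eq_mod_two, this]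
  · have h2 : 2 ^ k ≤ 2 ^ i := Nat.pow_le_pow_right (by norm_num) (by omega)
    rw [Nat.testBit_lt_two_pow (by omega), Nat.testBit_lt_two_pow (by omega)]

theorem johnson {ι : Type*} [DecidableEq ι] (G : Finset ι) (r : ℕ) (hr : 0 < r) (v : ι → ℕ → ℝ) (w : ℕ → ℝ)
    (β η : ℝ) (hβ : 0 ≤ β) (hη : 0 ≤ η) (hv : ∀ c x, v c x ^ 2 = 1) (hw : ∀ x, w x ^ 2 = 1)
    (h1 : ∀ c ∈ G, ∀ d ∈ G, c ≠ d → ∑ x ∈ Finset.range r, v c x * v d x ≤ η * r)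
    (h2 : ∀ c ∈ G, β * r ≤ - ∑ x ∈ Finset.range r, v c x * w x) :
    (G.card : ℝ) * (β ^ 2 - η) ≤ 1 := by
  have hr' : (0:ℝ) < r := by exact_mod_cast hr
  have hS : ∑ x ∈ Finset.range r, (∑ c ∈ G, v c x) ^ 2 ≤ G.card * r + G.card ^ 2 * (η * r) := by
    have e : ∑ x ∈ Finset.range r, (∑ c ∈ G, v c x) ^ 2
        = ∑ c ∈ G, ∑ d ∈ G, ∑ x ∈ Finset.range r, v c x * v d x := by
      simp_rw [sq, Finset.sum_mul_sum]
      rw [Finset.sum_comm]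
      refine Finset.sum_congr rfl fun c _ => Finset.sum_comm
    rw [e]
    have : ∀ c ∈ G, ∑ d ∈ G, ∑ x ∈ Finset.range r, v c x * v d x ≤
        ∑ d ∈ G, ((if c = d then (r:ℝ) else 0) + η * r) := by
      intro c hc
      refine Finset.sum_le_sum fun d hd => ?_
      by_cases h : c = d
      · subst h
        simp only [← sq, hv]
        simp; positivity
      · simpa [h] using h1 c hc d hd h
    refine (Finset.sum_le_sum this).trans ?_
    simp only [Finset.sum_add_distrib, Finset.sum_ite_eq, Finset.sum_const, nsmul_eq_mul]
    rw [Finset.sum_congr rfl (fun c hc => if_pos hc)]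
    simp only [Finset.sum_const, nsmul_eq_mul]
    apply le_of_eq; ring
  have hC := Finset.sum_mul_sq_le_sq_mul_sq (Finset.range r) (fun x => ∑ c ∈ G, v c x) w
  have hT : (G.card : ℝ) * (β * r) ≤ - ∑ x ∈ Finset.range r, (∑ c ∈ G, v c x) * w x := by
    simp_rw [Finset.sum_mul]
    rw [Finset.sum_comm, ← Finset.sum_neg_distrib, ← nsmul_eq_mul, ← Finset.sum_const]
    exact Finset.sum_le_sum h2
  have hW : ∑ x ∈ Finset.range r, w x ^ 2 = r := by simp [hw]
  rw [hW] at hC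
  have h3 : ((G.card : ℝ) * (β * r))^2 ≤ (G.card * r + G.card ^ 2 * (η * r)) * r := by
    have : 0 ≤ (G.card : ℝ) * (β * r) := by positivity
    calc _ ≤ (- ∑ x ∈ Finset.range r, (∑ c ∈ G, v c x) * w x)^2 := by gcongr
      _ = (∑ x ∈ Finset.range r, (∑ c ∈ G, v c x) * w x)^2 := by ring
      _ ≤ _ := hC
      _ ≤ _ := by gcongr
  rcases Nat.eq_zero_or_pos G.card with h0 | h0
  · simp [h0]
  have h0' : (0:ℝ) < G.card := by exact_mod_cast h0
  have : (G.card : ℝ) * r^2 * ((G.card : ℝ) * (β ^ 2 - η)) ≤ (G.card : ℝ) * r^2 * 1 := by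
    nlinarith
  exact le_of_mul_le_mul_left this (by positivity)

/-- sign -/
def sg (n : ℕ) : ℝ := (-1) ^ n

theorem sg_sq (n : ℕ) : sg n ^ 2 = 1 := by
  rw [sg, ← pow_mul, mul_comm, pow_mul]; simp

theorem sg_mod (n : ℕ) : sg (n % 2) = sg n := by
  rw [sg, sg]; exact (neg_one_pow_eq_pow_mod_two n).symm

theorem sg_mul_eq {a b : ℕ} (ha : a < 2) (hb : b < 2) :
    sg a * sg b = 2 * (if b = a then 1 else 0) - 1 := by
  interval_cases a <;> interval_cases b <;> norm_num [sg]

/-- Hadamard code -/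
def had (m u b : ℕ) : ℕ := (∑ i ∈ Finset.range m, dig u i * dig b i) % 2

theorem had_lt (m u b : ℕ) : had m u b < 2 := Nat.mod_lt _ (by norm_num)

theorem sum_prod_dig (m : ℕ) (φ : ℕ → ℕ → ℝ) :
    ∑ b ∈ Finset.range (2 ^ m), ∏ i ∈ Finset.range m, φ i (dig b i)
      = ∏ i ∈ Finset.range m, (φ i 0 + φ i 1) := by
  induction m with
  | zero => simp
  | succ m ih =>
    rw [pow_succ, mul_two, Finset.sum_range_add, Finset.prod_range_succ, ← ih, mul_add,
      Finset.sum_mul, Finset.sum_mul]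
    congr 1
    · refine Finset.sum_congr rfl fun b hb => ?_
      rw [Finset.prod_range_succ]
      have : dig b m = 0 := by
        rw [dig, Nat.div_eq_of_lt (Finset.mem_range.1 hb)]
      rw [this]
    · refine Finset.sum_congr rfl fun b hb => ?_
      rw [Finset.prod_range_succ]
      have : dig (2 ^ m + b) m = 1 := by
        rw [dig, Nat.add_div_left _ (by positivity), Nat.div_eq_of_lt (Finset.mem_range.1 hb)]
      rw [this]
      congr 1
      refine Finset.prod_congr rfl fun i hi => ?_
      congr 1
      obtain ⟨t, rfl⟩ : ∃ t, m = i + 1 + t := ⟨m - (i+1), by have := Finset.mem_range.1 hi; omega⟩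
      rw [dig, dig, show 2 ^ (i+1+t) + b = b + 2 ^ i * (2 * 2 ^ t) by ring,
        Nat.add_mul_div_left _ _ (by positivity), Nat.add_mul_mod_self_left]

theorem had_orth (m u v : ℕ) (hu : u < 2 ^ m) (hv : v < 2 ^ m) (huv : u ≠ v) :
    ∑ b ∈ Finset.range (2 ^ m), sg (had m u b) * sg (had m v b) = 0 := by
  have e : ∀ b, sg (had m u b) * sg (had m v b)
      = ∏ i ∈ Finset.range m, (fun i x => sg ((dig u i + dig v i) * x)) i (dig b i) := by
    intro b
    simp only [had, sg_mod]
    simp only [sg]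
    rw [Finset.prod_pow_eq_pow_sum, ← pow_add, ← Finset.sum_add_distrib]
    congr 1
    exact Finset.sum_congr rfl fun i _ => by ring
  rw [Finset.sum_congr rfl fun b _ => e b,
    sum_prod_dig m (fun i x => sg ((dig u i + dig v i) * x))]
  obtain ⟨i, hi, hne⟩ : ∃ i < m, dig u i ≠ dig v i := by
    by_contra! h
    exact huv (dig_ext hu hv h)
  refine Finset.prod_eq_zero (Finset.mem_range.2 hi) ?_
  have h1 := dig_lt u i
  have h2 := dig_lt v i
  have : dig u i + dig v i = 1 := by omega
  simp [this, sg]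

/-- largest prime `≤ n` -/
def bigP (n : ℕ) : ℕ :=
  Nat.rec 0 (fun y ih => if ∑ d ∈ Finset.range (y+1), (if (y + 1) % d = 0 then 1 else 0) = 1
    then y + 1 else ih) n

theorem prime_test (p : ℕ) :
    ∑ d ∈ Finset.range p, (if p % d = 0 then 1 else 0) = 1 ↔ p.Prime := by
  rw [← Finset.card_filter]
  constructor
  · intro h
    have h2 : 2 ≤ p := by
      by_contra! h'
      interval_cases p <;> simp at h
    rw [Nat.prime_def_lt]
    refine ⟨h2, fun m hm hd => ?_⟩
    obtain ⟨a, ha⟩ := Finset.card_eq_one.1 h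
    have m1 : 1 ∈ ({a} : Finset ℕ) := by rw [← ha]; simp; omega
    have m2 : m ∈ ({a} : Finset ℕ) := by rw [← ha]; simp [hm, Nat.mod_eq_zero_of_dvd hd]
    simp at m1 m2; omega
  · intro h
    rw [Finset.card_eq_one]
    refine ⟨1, ?_⟩
    ext m
    simp only [Finset.mem_filter, Finset.mem_range, Finset.mem_singleton]
    constructor
    · rintro ⟨h1, h2⟩
      exact (Nat.prime_def_lt.1 h).2 m h1 (Nat.dvd_of_mod_eq_zero h2)
    · rintro rfl
      exact ⟨h.one_lt, Nat.mod_one _⟩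

theorem bigP_succ (n : ℕ) : bigP (n+1) = if (n+1).Prime then n + 1 else bigP n := by
  simp only [bigP, prime_test]

theorem bigP_spec (n p : ℕ) (hp : p.Prime) (hn : p ≤ n) :
    (bigP n).Prime ∧ p ≤ bigP n ∧ bigP n ≤ n := by
  induction n with
  | zero => have := hp.pos; omega
  | succ n ih =>
    rw [bigP_succ]
    split_ifs with h
    · exact ⟨h, hn, le_rfl⟩
    · have : p ≠ n + 1 := fun e => h (e ▸ hp)
      obtain ⟨a, b, c⟩ := ih (by omega)
      exact ⟨a, b, by omega⟩

theorem c_bigP {α : Type*} [Primcodable α] {f : α → ℕ} (hf : Computable f) :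
    Computable fun a => bigP (f a) := by
  refine Computable.nat_rec (σ := ℕ) hf (Computable.const 0)
    (h := fun _ p => if ∑ d ∈ Finset.range (p.1+1), (if (p.1 + 1) % d = 0 then 1 else 0) = 1
      then p.1 + 1 else p.2) ?_
  have hy : Computable fun p : α × ℕ × ℕ => p.2.1 + 1 :=
    c_add (Computable.fst.comp Computable.snd) (Computable.const 1)
  refine c_ite_eq ?_ (Computable.const 1) hy (Computable.snd.comp Computable.snd)
  refine c_sum (f := fun (p : α × ℕ × ℕ) d => if (p.2.1 + 1) % d = 0 then 1 else 0) ?_ hy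
  exact c_ite_eq (c_mod (hy.comp Computable.fst) Computable.snd) (Computable.const 0)
    (Computable.const 1) (Computable.const 0)

def mm (q : ℕ) : ℕ := q / 2 + 1
def pp (q : ℕ) : ℕ := bigP (2 ^ mm q)

theorem pp_spec (q : ℕ) : (pp q).Prime ∧ 2 ^ (q - mm q) ≤ pp q ∧ pp q ≤ 2 ^ mm q := by
  obtain ⟨p, h1, h2, h3⟩ := Nat.exists_prime_lt_and_le_two_mul (2 ^ (q / 2)) (by positivity)
  obtain ⟨a, b, c⟩ := bigP_spec (2 ^ mm q) p h1 (by rw [mm, pow_succ]; omega)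
  refine ⟨a, ?_, c⟩
  have : 2 ^ (q - mm q) ≤ 2 ^ (q / 2) := Nat.pow_le_pow_right (by norm_num) (by rw [mm]; omega)
  rw [pp]; omega

def ply (k p : ℕ) (c : ℕ → ℕ) (a : ℕ) : ℕ := (∑ i ∈ Finset.range k, c i * a ^ i) % p

def cw (q k : ℕ) (c : ℕ → ℕ) (x : ℕ) : ℕ :=
  had (mm q) (ply k (pp q) c (x / 2 ^ mm q)) (x % 2 ^ mm q)

theorem cw_lt (q k : ℕ) (c : ℕ → ℕ) (x : ℕ) : cw q k c x < 2 := had_lt _ _ _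

theorem c_cw {α : Type*} [Primcodable α] {q k x : α → ℕ} {c : α → ℕ → ℕ} (hq : Computable q)
    (hk : Computable k) (hx : Computable x) (hc : Computable fun p : α × ℕ => c p.1 p.2) :
    Computable fun a => cw (q a) (k a) (c a) (x a) := by
  have hm : Computable fun a => mm (q a) :=
    c_add (c_div hq (Computable.const 2)) (Computable.const 1)
  have h2m : Computable fun a => 2 ^ mm (q a) := c_pow (Computable.const 2) hm
  have hp : Computable fun a => pp (q a) := c_bigP h2m
  have hu : Computable fun a => ply (k a) (pp (q a)) (c a) (x a / 2 ^ mm (q a)) := by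
    refine c_mod (c_sum (f := fun a i => c a i * (x a / 2 ^ mm (q a)) ^ i) ?_ hk) hp
    exact c_mul hc (c_pow ((c_div hx h2m).comp Computable.fst) Computable.snd)
  refine c_mod (c_sum (f := fun a i => dig (ply (k a) (pp (q a)) (c a) (x a / 2 ^ mm (q a))) i *
    dig (x a % 2 ^ mm (q a)) i) ?_ hm) (Computable.const 2)
  exact c_mul (c_dig (hu.comp Computable.fst) Computable.snd)
    (c_dig ((c_mod hx h2m).comp Computable.fst) Computable.snd)

open Polynomial in
theorem root_count (k p R : ℕ) (hp : p.Prime) (hR : R ≤ p) (c d : ℕ → ℕ) (hc : ∀ i, c i < 2)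
    (hd : ∀ i, d i < 2) (hne : ∃ i < k, c i ≠ d i) :
    ((Finset.range R).filter fun a => ply k p c a = ply k p d a).card ≤ k := by
  have : Fact p.Prime := ⟨hp⟩
  set P : (ZMod p)[X] := ∑ i ∈ Finset.range k, C ((c i : ZMod p) - d i) * X ^ i with hP
  have hcoef : ∀ i < k, P.coeff i = (c i : ZMod p) - d i := by
    intro i hi
    rw [hP, Polynomial.finsetSum_coeff]
    simp only [coeff_C_mul, coeff_X_pow]
    simp [hi]
  have hP0 : P ≠ 0 := by
    obtain ⟨i, hi, hne⟩ := hne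
    intro h
    have := hcoef i hi
    rw [h, coeff_zero] at this
    have h2 : (c i : ZMod p) = d i := (sub_eq_zero.1 this.symm)
    rw [ZMod.natCast_eq_natCast_iff'] at h2
    have := hc i; have := hd i; have := hp.two_le
    rw [Nat.mod_eq_of_lt (by omega), Nat.mod_eq_of_lt (by omega)] at h2
    exact hne h2
  have hdeg : P.natDegree ≤ k := by
    refine natDegree_sum_le_of_forall_le _ _ fun i hi => ?_
    exact (natDegree_C_mul_X_pow_le _ _).trans (Finset.mem_range.1 hi).le
  have hle : ((Finset.range R).filter fun a => ply k p c a = ply k p d a).card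
      ≤ P.roots.toFinset.card := by
    refine Finset.card_le_card_of_injOn (fun a => (a : ZMod p)) ?_ ?_
    · intro a ha
      simp only [Finset.coe_filter, Finset.mem_range, Set.mem_ofPred_eq] at ha
      simp only [Finset.mem_coe, Multiset.mem_toFinset, mem_roots hP0, IsRoot.def]
      have := ha.2
      simp only [ply] at this
      rw [← ZMod.natCast_eq_natCast_iff'] at this
      push_cast at this
      simp only [hP, eval_finsetSum, eval_mul, eval_C, eval_pow, eval_X, sub_mul,
        Finset.sum_sub_distrib, this, sub_self]
    · intro a ha b hb hab
      simp only [Finset.coe_filter, Finset.mem_range, Set.mem_ofPred_eq] at ha hb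
      dsimp only at hab
      rw [ZMod.natCast_eq_natCast_iff', Nat.mod_eq_of_lt (by omega),
        Nat.mod_eq_of_lt (by omega)] at hab
      exact hab
  exact hle.trans ((Multiset.toFinset_card_le _).trans ((card_roots' P).trans hdeg))

theorem sum_range_mul' (A B : ℕ) (f : ℕ → ℝ) : ∑ x ∈ Finset.range (A * B), f x
    = ∑ a ∈ Finset.range A, ∑ b ∈ Finset.range B, f (a * B + b) := by
  induction A with
  | zero => simp
  | succ A ih => rw [Nat.succ_mul, Finset.sum_range_add, ih, Finset.sum_range_succ]

theorem cw_inner (q k : ℕ) (hq : 1 ≤ q) (c d : ℕ → ℕ) (hc : ∀ i, c i < 2)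
    (hd : ∀ i, d i < 2) (hne : ∃ i < k, c i ≠ d i) :
    ∑ x ∈ Finset.range (2 ^ q), sg (cw q k c x) * sg (cw q k d x) ≤ k * 2 ^ mm q := by
  obtain ⟨h1, h2, h3⟩ := pp_spec q
  have hq2 : 2 ^ q = 2 ^ (q - mm q) * 2 ^ mm q := by
    rw [← pow_add]; congr 1; simp only [mm]; omega
  rw [hq2, sum_range_mul']
  have hu : ∀ c a, ply k (pp q) c a < 2 ^ mm q := fun c a =>
    (Nat.mod_lt _ h1.pos).trans_le h3
  have key : ∀ a ∈ Finset.range (2 ^ (q - mm q)), ∑ b ∈ Finset.range (2 ^ mm q),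
      sg (cw q k c (a * 2 ^ mm q + b)) * sg (cw q k d (a * 2 ^ mm q + b))
      ≤ if ply k (pp q) c a = ply k (pp q) d a then (2:ℝ) ^ mm q else 0 := by
    intro a _
    have e : ∀ b ∈ Finset.range (2 ^ mm q), sg (cw q k c (a * 2 ^ mm q + b)) *
        sg (cw q k d (a * 2 ^ mm q + b)) = sg (had (mm q) (ply k (pp q) c a) b) *
        sg (had (mm q) (ply k (pp q) d a) b) := by
      intro b hb
      have hb := Finset.mem_range.1 hb
      have e1 : (a * 2 ^ mm q + b) / 2 ^ mm q = a := by
        rw [mul_comm, Nat.mul_add_div (by positivity), Nat.div_eq_of_lt hb, add_zero]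
      have e2 : (a * 2 ^ mm q + b) % 2 ^ mm q = b := by
        rw [mul_comm, Nat.mul_add_mod, Nat.mod_eq_of_lt hb]
      simp only [cw, e1, e2]
    rw [Finset.sum_congr rfl e]
    split_ifs with h
    · rw [h]
      simp only [← sq, sg_sq]
      simp
    · rw [had_orth _ _ _ (hu _ _) (hu _ _) h]
  refine (Finset.sum_le_sum key).trans ?_
  rw [← Finset.sum_filter, Finset.sum_const, nsmul_eq_mul]
  have := root_count k (pp q) _ h1 h2 c d hc hd hne
  gcongr

/-- agreement count with a block of Y -/
def agr (Y : ℕ → ℕ) (q k base : ℕ) (c : ℕ → ℕ) : ℕ :=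
  ∑ x ∈ Finset.range (2 ^ q), if Y (base + x) = cw q k c x then 1 else 0

theorem list_size (Y : ℕ → ℕ) (hY : ∀ n, Y n < 2) (q k base τ : ℕ) (hq : 1 ≤ q)
    (hk : k * 2 ^ mm q * 2 ^ (2 * τ + 1) ≤ 2 ^ q) :
    ((Finset.range (2 ^ k)).filter fun c =>
      2 * 2 ^ τ * agr Y q k base (dig c) ≤ (2 ^ τ - 1) * 2 ^ q).card ≤ 2 ^ (2 * τ + 1) := by
  set G := (Finset.range (2 ^ k)).filter fun c =>
      2 * 2 ^ τ * agr Y q k base (dig c) ≤ (2 ^ τ - 1) * 2 ^ q with hG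
  have hT : (0:ℝ) < 2 ^ τ := by positivity
  have J := johnson G (2 ^ q) (by positivity) (fun c x => sg (cw q k (dig c) x))
    (fun x => sg (Y (base + x))) (1 / 2 ^ τ) (1 / (2 * (2 ^ τ) ^ 2)) (by positivity) (by positivity)
    (fun c x => sg_sq _) (fun x => sg_sq _) ?_ ?_
  · have : ((2 ^ (2 * τ + 1) : ℕ) : ℝ) = 2 * (2 ^ τ) ^ 2 := by push_cast; ring
    have h2 : (G.card : ℝ) ≤ (2 ^ (2 * τ + 1) : ℕ) := by
      rw [this]
      have e : (1 / (2:ℝ) ^ τ) ^ 2 - 1 / (2 * (2 ^ τ) ^ 2) = 1 / (2 * (2 ^ τ) ^ 2) := by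
        field_simp; norm_num
      rw [e, mul_one_div, div_le_one (by positivity)] at J
      exact J
    exact_mod_cast h2
  · intro c hc d hd hcd
    have hc' := Finset.mem_range.1 (Finset.mem_filter.1 hc).1
    have hd' := Finset.mem_range.1 (Finset.mem_filter.1 hd).1
    have hne : ∃ i < k, dig c i ≠ dig d i := by
      by_contra! h
      exact hcd (dig_ext hc' hd' h)
    refine (cw_inner q k hq (dig c) (dig d) (dig_lt c) (dig_lt d) hne).trans ?_
    have hk' : (k : ℝ) * 2 ^ mm q * 2 ^ (2 * τ + 1) ≤ 2 ^ q := by exact_mod_cast hk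
    rw [one_div_mul_eq_div, le_div_iff₀ (by positivity)]
    push_cast
    calc _ = (k : ℝ) * 2 ^ mm q * 2 ^ (2 * τ + 1) := by ring
      _ ≤ _ := hk'
  · intro c hc
    have hc' := (Finset.mem_filter.1 hc).2
    have e : ∑ x ∈ Finset.range (2 ^ q), sg (cw q k (dig c) x) * sg (Y (base + x))
        = 2 * (agr Y q k base (dig c) : ℝ) - 2 ^ q := by
      rw [Finset.sum_congr rfl fun x _ => sg_mul_eq (cw_lt q k (dig c) x) (hY (base + x))]
      rw [Finset.sum_sub_distrib, ← Finset.mul_sum]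
      simp [agr]
    have h3 : (2:ℝ) * 2 ^ τ * agr Y q k base (dig c) ≤ (2 ^ τ - 1) * 2 ^ q := by
      have : ((2 * 2 ^ τ * agr Y q k base (dig c) : ℕ) : ℝ) ≤ ((2 ^ τ - 1) * 2 ^ q : ℕ) := by
        exact_mod_cast hc'
      have h1 : 1 ≤ 2 ^ τ := Nat.one_le_two_pow
      push_cast [Nat.cast_sub h1] at this
      exact this
    rw [e, one_div_mul_eq_div, div_le_iff₀ hT]
    push_cast
    nlinarith

def good (Y : ℕ → ℕ) (τ q k base c : ℕ) : ℕ :=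
  if 2 * 2 ^ τ * agr Y q k base (dig c) ≤ (2 ^ τ - 1) * 2 ^ q then 1 else 0

def sel (Y : ℕ → ℕ) (τ q k base l : ℕ) : ℕ :=
  ∑ c ∈ Finset.range (2 ^ k),
    if ∑ d ∈ Finset.range c, good Y τ q k base d = l then c * good Y τ q k base c else 0

theorem c_good {α : Type*} [Primcodable α] {Y : α → ℕ → ℕ} {q k base c : α → ℕ} (τ : ℕ)
    (hY : Computable fun p : α × ℕ => Y p.1 p.2) (hq : Computable q) (hk : Computable k)
    (hb : Computable base) (hc : Computable c) :
    Computable fun a => good (Y a) τ (q a) (k a) (base a) (c a) := by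
  have h2q : Computable fun a => 2 ^ q a := c_pow (Computable.const 2) hq
  refine c_ite_le (c_mul (Computable.const (2 * 2 ^ τ)) ?_)
    (c_mul (Computable.const (2 ^ τ - 1)) h2q) (Computable.const 1) (Computable.const 0)
  refine c_sum (f := fun a x => if Y a (base a + x) = cw (q a) (k a) (dig (c a)) x then 1 else 0)
    ?_ h2q
  refine c_ite_eq ?_ ?_ (Computable.const 1) (Computable.const 0)
  · exact hY.comp (Computable.fst.pair (c_add (hb.comp Computable.fst) Computable.snd))
  · refine c_cw (c := fun (p : α × ℕ) i => dig (c p.1) i) (hq.comp Computable.fst)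
      (hk.comp Computable.fst) Computable.snd ?_
    exact c_dig (hc.comp (Computable.fst.comp Computable.fst)) Computable.snd

theorem c_sel_abs {α : Type*} [Primcodable α] {g : α → ℕ → ℕ} {N : α → ℕ} (l : ℕ)
    (hg : Computable fun p : α × ℕ => g p.1 p.2) (hN : Computable N) :
    Computable fun a => ∑ c ∈ Finset.range (N a),
      if ∑ d ∈ Finset.range c, g a d = l then c * g a c else 0 := by
  have h1 : Computable fun p : α × ℕ => ∑ d ∈ Finset.range p.2, g p.1 d :=
    c_sum (f := fun (p : α × ℕ) d => g p.1 d) (g := fun p => p.2)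
      (hg.comp ((Computable.fst.comp Computable.fst).pair Computable.snd)) Computable.snd
  have h2 : Computable fun p : α × ℕ =>
      if ∑ d ∈ Finset.range p.2, g p.1 d = l then p.2 * g p.1 p.2 else 0 :=
    c_ite_eq (f := fun p : α × ℕ => ∑ d ∈ Finset.range p.2, g p.1 d) (g := fun _ => l)
      (u := fun p : α × ℕ => p.2 * g p.1 p.2) (v := fun _ => 0)
      h1 (Computable.const l) (c_mul Computable.snd hg) (Computable.const 0)
  exact c_sum (f := fun a c => if ∑ d ∈ Finset.range c, g a d = l then c * g a c else 0) h2 hN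

theorem c_sel {α : Type*} [Primcodable α] {Y : α → ℕ → ℕ} {q k base : α → ℕ} (τ l : ℕ)
    (hY : Computable fun p : α × ℕ => Y p.1 p.2) (hq : Computable q) (hk : Computable k)
    (hb : Computable base) :
    Computable fun a => sel (Y a) τ (q a) (k a) (base a) l := by
  have hg : Computable fun p : α × ℕ => good (Y p.1) τ (q p.1) (k p.1) (base p.1) p.2 := by
    refine c_good (Y := fun (p : α × ℕ) i => Y p.1 i) τ ?_ (hq.comp Computable.fst)
      (hk.comp Computable.fst) (hb.comp Computable.fst) Computable.snd
    exact hY.comp ((Computable.fst.comp Computable.fst).pair Computable.snd)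
  exact c_sel_abs (g := fun a c => good (Y a) τ (q a) (k a) (base a) c) (N := fun a => 2 ^ k a) l hg
    (c_pow (Computable.const 2) hk)

theorem sel_aux (g : ℕ → ℕ) (N c : ℕ) (hg : g c = 1) (hc : c < N) :
    ∑ e ∈ Finset.range N, (if ∑ d ∈ Finset.range e, g d = ∑ d ∈ Finset.range c, g d
      then e * g e else 0) = c := by
  rw [Finset.sum_eq_single c]
  · simp [hg]
  · intro e _ hne
    split_ifs with h
    · rcases Nat.eq_zero_or_pos (g e) with h0 | h0
      · simp [h0]
      exfalso
      rcases lt_or_gt_of_ne hne with h1 | h1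
      · have : ∑ d ∈ Finset.range (e+1), g d ≤ ∑ d ∈ Finset.range c, g d :=
          Finset.sum_le_sum_of_subset (Finset.range_mono h1)
        rw [Finset.sum_range_succ] at this; omega
      · have : ∑ d ∈ Finset.range (c+1), g d ≤ ∑ d ∈ Finset.range e, g d :=
          Finset.sum_le_sum_of_subset (Finset.range_mono h1)
        rw [Finset.sum_range_succ] at this; omega
    · rfl
  · intro h; exact absurd (Finset.mem_range.2 hc) h

theorem cw_congr {q k : ℕ} {c d : ℕ → ℕ} (h : ∀ i < k, c i = d i) (x : ℕ) :
    cw q k c x = cw q k d x := by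
  simp only [cw, ply]
  rw [Finset.sum_congr rfl fun i hi => by rw [h i (Finset.mem_range.1 hi)]]

theorem sel_exists (Y : ℕ → ℕ) (hY : ∀ n, Y n < 2) (q k base τ : ℕ) (hq : 1 ≤ q)
    (hk : k * 2 ^ mm q * 2 ^ (2 * τ + 1) ≤ 2 ^ q) (msg : ℕ → ℕ) (hm : ∀ i, msg i < 2)
    (h : 2 * 2 ^ τ * agr Y q k base msg ≤ (2 ^ τ - 1) * 2 ^ q) :
    ∃ l < 2 ^ (2 * τ + 1), ∀ i < k, dig (sel Y τ q k base l) i = msg i := by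
  set c := pre msg k with hc
  have hck : c < 2 ^ k := pre_lt hm k
  have hdig : ∀ i < k, dig c i = msg i := fun i hi => dig_pre hm hi
  have hg : good Y τ q k base c = 1 := by
    have : agr Y q k base (dig c) = agr Y q k base msg := by
      simp only [agr, cw_congr hdig]
    simp [good, this, h]
  refine ⟨∑ d ∈ Finset.range c, good Y τ q k base d, ?_, ?_⟩
  · have h1 := list_size Y hY q k base τ hq hk
    rw [Finset.card_filter] at h1
    have h2 : ∑ d ∈ Finset.range (c+1), good Y τ q k base d ≤
        ∑ d ∈ Finset.range (2 ^ k), good Y τ q k base d :=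
      Finset.sum_le_sum_of_subset (Finset.range_mono hck)
    rw [Finset.sum_range_succ, hg] at h2
    simp only [good] at h2 ⊢
    omega
  · have : sel Y τ q k base (∑ d ∈ Finset.range c, good Y τ q k base d) = c :=
      sel_aux _ _ _ hg hck
    rw [this]; exact hdig

/-- the decoded candidate -/
def FF (Y : ℕ → ℕ) (w τ l s ρ n : ℕ) : ℕ :=
  dig (sel Y τ (2 * (4 * τ + 3 + w) + 2 * w * (Nat.log 2 n / w) + ρ)
    (2 ^ (2 * τ + 1 + w * (Nat.log 2 n / w + 1)))
    (2 ^ (2 * (4 * τ + 3 + w) + 2 * w * (Nat.log 2 n / w) + ρ) * (2 ^ τ + s)) l)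
    (l * 2 ^ (w * (Nat.log 2 n / w + 1)) + n)

theorem FF_turing (Y A : ℕ → ℕ) (hY : ∀ n, Y n < 2) (hYA : TuringLE Y A) (w τ l s ρ : ℕ) :
    TuringLE (FF Y w τ l s ρ) A := by
  let Q : ℕ → ℕ := fun n => 2 * (4 * τ + 3 + w) + 2 * w * (Nat.log 2 n / w) + ρ
  let U : ℕ → ℕ := fun n => 2 ^ Q n * (2 ^ τ + s) + 2 ^ Q n
  have hj : Computable fun n : ℕ => Nat.log 2 n / w := c_div (c_log Computable.id) (Computable.const w)
  have hQ : Computable Q :=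
    c_add (c_add (Computable.const _) (c_mul (Computable.const (2 * w)) hj)) (Computable.const ρ)
  have hB : Computable fun n => 2 ^ Q n * (2 ^ τ + s) :=
    c_mul (c_pow (Computable.const 2) hQ) (Computable.const _)
  have hU : Computable U := c_add hB (c_pow (Computable.const 2) hQ)
  have hk1 : Computable fun n : ℕ => w * (Nat.log 2 n / w + 1) :=
    c_mul (Computable.const w) (c_add hj (Computable.const 1))
  have hH : Computable fun p : ℕ × ℕ => FF (dig p.2) w τ l s ρ p.1 := by
    refine c_dig ?_ (c_add (c_mul (Computable.const l)
      (c_pow (Computable.const 2) (hk1.comp Computable.fst))) Computable.fst)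
    refine c_sel (Y := fun (p : ℕ × ℕ) i => dig p.2 i) (q := fun p => Q p.1) τ l ?_ ?_ ?_ ?_
    · exact c_dig (Computable.snd.comp Computable.fst) Computable.snd
    · exact hQ.comp Computable.fst
    · exact c_pow (Computable.const 2) (c_add (Computable.const _) (hk1.comp Computable.fst))
    · exact hB.comp Computable.fst
  have h1 : TuringLE (fun n => FF (dig (pre Y (U n))) w τ l s ρ n) A :=
    TuringLE.apply₂ (H := fun n W => FF (dig W) w τ l s ρ n) (f := fun n => n) hH
      (TuringLE.of_computable A Computable.id) (hYA.pre'.comp' (TuringLE.of_computable A hU))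
  have e : FF Y w τ l s ρ = fun n => FF (dig (pre Y (U n))) w τ l s ρ n := by
    funext n
    have hg : ∀ k c, good Y τ (Q n) k (2 ^ Q n * (2 ^ τ + s)) c
        = good (dig (pre Y (U n))) τ (Q n) k (2 ^ Q n * (2 ^ τ + s)) c := by
      intro k c
      have : agr Y (Q n) k (2 ^ Q n * (2 ^ τ + s)) (dig c)
          = agr (dig (pre Y (U n))) (Q n) k (2 ^ Q n * (2 ^ τ + s)) (dig c) := by
        refine Finset.sum_congr rfl fun x hx => ?_
        rw [dig_pre hY]
        have := Finset.mem_range.1 hx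
        simp only [U]; omega
      simp only [good, this]
    have hs : ∀ k, sel Y τ (Q n) k (2 ^ Q n * (2 ^ τ + s)) l
        = sel (dig (pre Y (U n))) τ (Q n) k (2 ^ Q n * (2 ^ τ + s)) l := by
      intro k; simp only [sel, hg]
    simp only [FF]
    rw [hs]
  rw [e]; exact h1

theorem blocks (e : ℕ → ℕ) (τ Q : ℕ)
    (h : ∀ q, Q ≤ q → ∀ s < 2 ^ τ, (2 ^ τ - 1) * 2 ^ q <
      2 * 2 ^ τ * ∑ x ∈ Finset.range (2 ^ q), e (2 ^ q * (2 ^ τ + s) + x)) (q : ℕ) (hq : Q ≤ q)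
    (s : ℕ) (hs : s ≤ 2 ^ τ) :
    (2 ^ τ - 1) * (2 ^ q * (2 ^ τ + s)) ≤
      2 * 2 ^ τ * ∑ i ∈ Finset.range (2 ^ q * (2 ^ τ + s)), e i + (2 ^ τ - 1) * (2 ^ Q * 2 ^ τ) := by
  have step : ∀ q, Q ≤ q → (2 ^ τ - 1) * (2 ^ q * (2 ^ τ + 0)) ≤
      2 * 2 ^ τ * ∑ i ∈ Finset.range (2 ^ q * (2 ^ τ + 0)), e i + (2 ^ τ - 1) * (2 ^ Q * 2 ^ τ) →
      ∀ s ≤ 2 ^ τ, (2 ^ τ - 1) * (2 ^ q * (2 ^ τ + s)) ≤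
      2 * 2 ^ τ * ∑ i ∈ Finset.range (2 ^ q * (2 ^ τ + s)), e i
        + (2 ^ τ - 1) * (2 ^ Q * 2 ^ τ) := by
    intro q hq h0 s hs
    induction s with
    | zero => exact h0
    | succ s ih =>
      have := h q hq s (by omega)
      have ih := ih (by omega)
      have e1 : 2 ^ q * (2 ^ τ + (s+1)) = 2 ^ q * (2 ^ τ + s) + 2 ^ q := by ring
      rw [e1, Finset.sum_range_add]
      generalize 2 ^ q * (2 ^ τ + s) = M at *
      rw [Nat.mul_add, Nat.mul_add]
      omega
  refine step q hq ?_ s hs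
  induction q, hq using Nat.le_induction with
  | base => simp
  | succ q hq ih =>
    have := step q hq ih (2 ^ τ) le_rfl
    rw [show 2 ^ (q+1) * (2 ^ τ + 0) = 2 ^ q * (2 ^ τ + 2 ^ τ) by ring]
    exact this

theorem exists_block (e : ℕ → ℕ) (τ Q : ℕ) (c : ℝ) (hτ : 1 / 2 ^ τ < 1 / 2 - c)
    (h : ∃ᶠ N in atTop, ((∑ i ∈ Finset.range N, e i : ℕ) : ℝ) < c * N) :
    ∃ q, Q ≤ q ∧ ∃ s < 2 ^ τ, 2 * 2 ^ τ *
      ∑ x ∈ Finset.range (2 ^ q), e (2 ^ q * (2 ^ τ + s) + x) ≤ (2 ^ τ - 1) * 2 ^ q := by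
  by_contra! hb
  have hB := blocks e τ Q hb
  set T : ℝ := 2 ^ τ with hT
  have hT1 : 1 ≤ T := one_le_pow₀ (by norm_num)
  set δ : ℝ := 1 / 2 - c - 1 / T with hδ
  have hδ0 : 0 < δ := by simp only [hδ]; linarith
  obtain ⟨N, hN1, hN2⟩ := (h.and_eventually ((eventually_ge_atTop (2 ^ Q * 2 ^ τ)).and
    (eventually_ge_atTop (Nat.ceil ((2 ^ Q * T) / δ + 1))))).exists
  obtain ⟨hN2, hN3⟩ := hN2
  have hN0 : N ≠ 0 := by
    have : 0 < 2 ^ Q * 2 ^ τ := by positivity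
    omega
  have hlog : Q + τ ≤ Nat.log 2 N := by
    rw [Nat.le_log_iff_pow_le (by norm_num) hN0, pow_add]; exact hN2
  obtain ⟨q, hq⟩ : ∃ q, Nat.log 2 N = q + τ := ⟨Nat.log 2 N - τ, by omega⟩
  have hl1 : 2 ^ q * 2 ^ τ ≤ N := by rw [← pow_add, ← hq]; exact Nat.pow_log_le_self 2 hN0
  have hl2 : N < 2 ^ q * (2 ^ τ + 2 ^ τ) := by
    have := Nat.lt_pow_succ_log_self (b := 2) (by norm_num) N
    rw [hq] at this
    calc N < _ := this
      _ = _ := by rw [Nat.succ_eq_add_one]; ring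
  have hd1 : 2 ^ τ ≤ N / 2 ^ q := by
    rw [Nat.le_div_iff_mul_le (by positivity), mul_comm]; exact hl1
  have hd2 : N / 2 ^ q < 2 ^ τ + 2 ^ τ := by
    rw [Nat.div_lt_iff_lt_mul (by positivity), mul_comm]; exact hl2
  obtain ⟨s, hs⟩ : ∃ s, N / 2 ^ q = 2 ^ τ + s := ⟨N / 2 ^ q - 2 ^ τ, by omega⟩
  have hB := hB q (by omega) s (by omega)
  have hM1 : 2 ^ q * (2 ^ τ + s) ≤ N := by rw [← hs]; exact Nat.mul_div_le _ _
  have hM2 : N ≤ 2 ^ q * (2 ^ τ + s) + 2 ^ q := by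
    rw [← hs]
    have := Nat.div_add_mod N (2 ^ q)
    have := Nat.mod_lt N (show 0 < 2 ^ q by positivity)
    omega
  have hmono : ∑ i ∈ Finset.range (2 ^ q * (2 ^ τ + s)), e i ≤ ∑ i ∈ Finset.range N, e i :=
    Finset.sum_le_sum_of_subset (Finset.range_mono hM1)
  generalize hMdef : 2 ^ q * (2 ^ τ + s) = M at *
  have hB' : (2 ^ τ - 1) * M ≤ 2 * 2 ^ τ * ∑ i ∈ Finset.range N, e i
      + (2 ^ τ - 1) * (2 ^ Q * 2 ^ τ) := hB.trans (by gcongr)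
  have hBR : (T - 1) * (M : ℝ) ≤ 2 * T * ((∑ i ∈ Finset.range N, e i : ℕ) : ℝ)
      + (T - 1) * (2 ^ Q * T) := by
    have := (Nat.cast_le (α := ℝ)).2 hB'
    have h1 : 1 ≤ 2 ^ τ := Nat.one_le_two_pow
    simpa only [Nat.cast_add, Nat.cast_mul, Nat.cast_sub h1, Nat.cast_pow, Nat.cast_ofNat,
      Nat.cast_one] using this
  generalize ((∑ i ∈ Finset.range N, e i : ℕ) : ℝ) = S at *
  have hM2' : (N : ℝ) ≤ M + 2 ^ q := by exact_mod_cast hM2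
  have hl1' : (2:ℝ) ^ q * T ≤ N := by
    rw [hT]; exact_mod_cast hl1
  have hN3' : (2 ^ Q * T) / δ + 1 ≤ N := Nat.ceil_le.1 hN3
  have hN4 : 2 ^ Q * T < δ * N := by
    have : (2 ^ Q * T) / δ < N := by linarith
    rw [div_lt_iff₀ hδ0] at this
    linarith
  have hN0' : (0:ℝ) ≤ N := Nat.cast_nonneg N
  have h1T : (1 / T) * T = 1 := by field_simp
  -- multiply everything by T
  have a1 : (T - 1) * (N : ℝ) - (T - 1) * 2 ^ q ≤ (T - 1) * M := by nlinarith
  have a2 : (T - 1) * (2:ℝ) ^ q ≤ N := by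
    have : (0:ℝ) < 2 ^ q := by positivity
    nlinarith
  have a3 : (T - 2) * (N : ℝ) ≤ 2 * T * S + T * (2 ^ Q * T) := by
    have : (0:ℝ) ≤ 2 ^ Q * T := by positivity
    nlinarith
  have a4 : 2 * T * S ≤ 2 * T * (c * N) := by
    have := hN1.le
    gcongr
  have a5 : T * (2 ^ Q * T) ≤ T * (δ * N) := by gcongr
  have a6 : 2 * T * (2 ^ Q * T) < 2 * T * (δ * N) := by
    apply mul_lt_mul_of_pos_left hN4; linarith
  have a7 : 2 * T * (δ * N) = T * N - 2 * T * (c * N) - 2 * N := by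
    have : 2 * T * (δ * N) = T * N - 2 * T * (c * N) - 2 * ((1 / T) * T) * N := by
      simp only [hδ]; ring
    rw [this, h1T]; ring
  have : (0:ℝ) < 2 ^ Q * T := by positivity
  nlinarith

/-- the message encoded near `n` -/
def msgq (V : ℕ → ℕ → ℕ) (w c0 s q i : ℕ) : ℕ :=
  V (Nat.pair (i / 2 ^ (w * ((q - c0) / (2 * w) + 1))) (Nat.pair s ((q - c0) % (2 * w))))
    (i % 2 ^ (w * ((q - c0) / (2 * w) + 1)))

/-- the computable sequence obtained by encoding -/
def XE (V : ℕ → ℕ → ℕ) (w τ c0 n : ℕ) : ℕ :=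
  cw (Nat.log 2 n - τ) (2 ^ (2 * τ + 1 + w * ((Nat.log 2 n - τ - c0) / (2 * w) + 1)))
    (msgq V w c0 (n / 2 ^ (Nat.log 2 n - τ) - 2 ^ τ) (Nat.log 2 n - τ))
    (n % 2 ^ (Nat.log 2 n - τ))

theorem c_XE (V : ℕ → ℕ → ℕ) (hV : Computable fun p : ℕ × ℕ => V p.1 p.2) (w τ c0 : ℕ) :
    Computable (XE V w τ c0) := by
  have hq : Computable fun n : ℕ => Nat.log 2 n - τ := c_sub (c_log Computable.id) (Computable.const τ)
  have h2q : Computable fun n : ℕ => 2 ^ (Nat.log 2 n - τ) := c_pow (Computable.const 2) hq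
  have hqc : Computable fun n : ℕ => Nat.log 2 n - τ - c0 := c_sub hq (Computable.const c0)
  have hj : Computable fun n : ℕ => w * ((Nat.log 2 n - τ - c0) / (2 * w) + 1) :=
    c_mul (Computable.const w) (c_add (c_div hqc (Computable.const (2 * w))) (Computable.const 1))
  have hρ : Computable fun n : ℕ => (Nat.log 2 n - τ - c0) % (2 * w) :=
    c_mod hqc (Computable.const (2 * w))
  have hs : Computable fun n : ℕ => n / 2 ^ (Nat.log 2 n - τ) - 2 ^ τ :=
    c_sub (c_div Computable.id h2q) (Computable.const _)
  have hp : Computable fun p : ℕ × ℕ => 2 ^ (w * ((Nat.log 2 p.1 - τ - c0) / (2 * w) + 1)) :=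
    c_pow (Computable.const 2) (hj.comp Computable.fst)
  refine c_cw (q := fun n => Nat.log 2 n - τ)
    (k := fun n => 2 ^ (2 * τ + 1 + w * ((Nat.log 2 n - τ - c0) / (2 * w) + 1)))
    (x := fun n => n % 2 ^ (Nat.log 2 n - τ))
    (c := fun n => msgq V w c0 (n / 2 ^ (Nat.log 2 n - τ) - 2 ^ τ) (Nat.log 2 n - τ))
    hq (c_pow (Computable.const 2) (c_add (Computable.const _) hj)) (c_mod Computable.id h2q) ?_
  exact hV.comp ((c_pair (c_div Computable.snd hp)
    (c_pair (hs.comp Computable.fst) (hρ.comp Computable.fst))).pair (c_mod Computable.snd hp))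

theorem XE_block (V : ℕ → ℕ → ℕ) (w τ c0 q s x : ℕ) (hs : s < 2 ^ τ) (hx : x < 2 ^ q) :
    XE V w τ c0 (2 ^ q * (2 ^ τ + s) + x) =
      cw q (2 ^ (2 * τ + 1 + w * ((q - c0) / (2 * w) + 1))) (msgq V w c0 s q) x := by
  have hp : 0 < 2 ^ q := by positivity
  have hlog : Nat.log 2 (2 ^ q * (2 ^ τ + s) + x) = q + τ := by
    apply Nat.log_eq_of_pow_le_of_lt_pow
    · rw [pow_add, Nat.mul_add]; omega
    · calc 2 ^ q * (2 ^ τ + s) + x < 2 ^ q * (2 ^ τ + s) + 2 ^ q := by omega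
        _ = 2 ^ q * (2 ^ τ + s + 1) := by ring
        _ ≤ 2 ^ q * (2 ^ τ + 2 ^ τ) := Nat.mul_le_mul_left _ (by omega)
        _ = _ := by ring
  have hd : (2 ^ q * (2 ^ τ + s) + x) / 2 ^ q = 2 ^ τ + s := by
    rw [Nat.mul_add_div hp, Nat.div_eq_of_lt hx, add_zero]
  have hm : (2 ^ q * (2 ^ τ + s) + x) % 2 ^ q = x := by
    rw [Nat.mul_add_mod, Nat.mod_eq_of_lt hx]
  simp only [XE, hlog, Nat.add_sub_cancel, hd, hm, Nat.add_sub_cancel_left]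

theorem core (Y A : ℕ → ℕ) (hY : IsBitSeq Y) (hYA : TuringLE Y A) (c : ℝ) (hc : c < 1 / 2)
    (h : ∀ X, IsBitSeq X → Computable X → ∃ᶠ N in atTop,
      ((∑ i ∈ Finset.range N, if Y i = X i then 1 else 0 : ℕ) : ℝ) < c * (N : ℕ)) (w : ℕ) (hw : 1 ≤ w) :
    ∃ F, IsBitSeq F ∧ TuringLE F A ∧ ∀ X, IsBitSeq X → Computable X → ∃ᶠ j in atTop,
      ∀ n, 2 ^ (w * j) ≤ n → n < 2 ^ (w * (j + 1)) → F n = X n := by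
  obtain ⟨τ, hτ⟩ : ∃ τ : ℕ, (1:ℝ) / 2 ^ τ < 1 / 2 - c := by
    obtain ⟨τ, hτ⟩ := exists_pow_lt_of_lt_one (show (0:ℝ) < 1 / 2 - c by linarith)
      (show (1 / 2 : ℝ) < 1 by norm_num)
    exact ⟨τ, by rwa [one_div_pow] at hτ⟩
  by_contra! hcon
  have h1 : ∀ a : ℕ, ∃ X, ∃ J : ℕ, IsBitSeq X ∧ Computable X ∧ ∀ j, J ≤ j →
      ∃ n, 2 ^ (w * j) ≤ n ∧ n < 2 ^ (w * (j + 1)) ∧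
        FF Y w τ a.unpair.1 a.unpair.2.unpair.1 a.unpair.2.unpair.2 n ≠ X n := by
    intro a
    obtain ⟨X, hX1, hX2, hX3⟩ := hcon (FF Y w τ a.unpair.1 a.unpair.2.unpair.1 a.unpair.2.unpair.2)
      (fun n => dig_lt _ _) (FF_turing Y A hY hYA _ _ _ _ _)
    rw [eventually_atTop] at hX3
    obtain ⟨J, hJ⟩ := hX3
    exact ⟨X, J, hX1, hX2, hJ⟩
  choose X J hXb hXc hXJ using h1
  set Nb := Nat.pair (2 ^ (2 * τ + 1)) (Nat.pair (2 ^ τ) (2 * w)) with hNb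
  set V : ℕ → ℕ → ℕ := fun a n => if Nb ≤ a then 0 else X a n with hV
  have hVc : Computable fun p : ℕ × ℕ => V p.1 p.2 := c_family X hXc Nb
  have hVb : ∀ a n, V a n < 2 := by
    intro a n; simp only [hV]; split_ifs
    · norm_num
    · exact hXb a n
  set JJ := (Finset.range Nb).sup J with hJJ
  set c0 := 2 * (4 * τ + 3 + w) with hc0
  obtain ⟨q, hq, s, hs, hqs⟩ := exists_block
    (fun i => if Y i = XE V w τ c0 i then 1 else 0) τ (c0 + 2 * w * (JJ + 1)) c hτ
    (h _ (fun n => cw_lt _ _ _ _) (c_XE V hVc w τ c0))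
  set j := (q - c0) / (2 * w) with hj
  set ρ := (q - c0) % (2 * w) with hρ
  have hρlt : ρ < 2 * w := Nat.mod_lt _ (by omega)
  have hqc : c0 ≤ q := le_trans (Nat.le_add_right _ _) hq
  have hqe : q = c0 + 2 * w * j + ρ := by
    have := Nat.div_add_mod (q - c0) (2 * w)
    rw [← hj, ← hρ] at this
    omega
  have hjJ : JJ ≤ j := by
    have : JJ + 1 ≤ j := by
      rw [hj, Nat.le_div_iff_mul_le (by omega), mul_comm]
      omega
    omega
  set k := 2 ^ (2 * τ + 1 + w * (j + 1)) with hk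
  have hagr : 2 * 2 ^ τ * agr Y q k (2 ^ q * (2 ^ τ + s)) (msgq V w c0 s q)
      ≤ (2 ^ τ - 1) * 2 ^ q := by
    have e : agr Y q k (2 ^ q * (2 ^ τ + s)) (msgq V w c0 s q) =
        ∑ x ∈ Finset.range (2 ^ q), if Y (2 ^ q * (2 ^ τ + s) + x) =
          XE V w τ c0 (2 ^ q * (2 ^ τ + s) + x) then 1 else 0 := by
      refine Finset.sum_congr rfl fun x hx => ?_
      rw [XE_block V w τ c0 q s x hs (Finset.mem_range.1 hx)]
    rw [e]; exact hqs
  have hkb : k * 2 ^ mm q * 2 ^ (2 * τ + 1) ≤ 2 ^ q := by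
    rw [hk, ← pow_add, ← pow_add]
    apply Nat.pow_le_pow_right (by norm_num)
    have e1 : w * (j + 1) = w * j + w := by ring
    have e2 : 2 * w * j = 2 * (w * j) := by ring
    rw [e1, mm]
    rw [e2] at hqe
    omega
  obtain ⟨l, hl, hdec⟩ := sel_exists Y hY q k (2 ^ q * (2 ^ τ + s)) τ (by omega) hkb
    (msgq V w c0 s q) (fun i => hVb _ _) hagr
  set a := Nat.pair l (Nat.pair s ρ) with ha
  have haN : a < Nb :=
    (Nat.pair_lt_pair_left _ hl).trans (Nat.pair_lt_pair_right _
      ((Nat.pair_lt_pair_left _ hs).trans (Nat.pair_lt_pair_right _ hρlt)))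
  have hJa : J a ≤ j := le_trans (Finset.le_sup (Finset.mem_range.2 haN)) hjJ
  obtain ⟨n, hn1, hn2, hn3⟩ := hXJ a j hJa
  apply hn3
  simp only [ha, Nat.unpair_pair]
  have hn0 : n ≠ 0 := by
    have : 0 < 2 ^ (w * j) := by positivity
    omega
  have hlog : Nat.log 2 n / w = j := by
    have l1 : w * j ≤ Nat.log 2 n := by
      rw [Nat.le_log_iff_pow_le (by norm_num) hn0]; exact hn1
    have l2 : Nat.log 2 n < w * (j + 1) := Nat.log_lt_of_lt_pow hn0 hn2
    apply Nat.div_eq_of_lt_le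
    · rw [mul_comm]; exact l1
    · rw [mul_comm]; exact l2
  have hpw : 0 < 2 ^ (w * (j + 1)) := by positivity
  have hik : l * 2 ^ (w * (j + 1)) + n < k := by
    calc l * 2 ^ (w * (j + 1)) + n < l * 2 ^ (w * (j + 1)) + 2 ^ (w * (j + 1)) := by omega
      _ = (l + 1) * 2 ^ (w * (j + 1)) := by ring
      _ ≤ 2 ^ (2 * τ + 1) * 2 ^ (w * (j + 1)) := by gcongr; omega
      _ = k := by rw [hk, pow_add 2 (2 * τ + 1)]
  have hfin := hdec _ hik
  simp only [FF, hlog]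
  rw [← hc0, ← hqe, ← hk, hfin]
  simp only [msgq]
  rw [← hj, ← hρ, mul_comm l, Nat.mul_add_div hpw, Nat.div_eq_of_lt hn2, add_zero, Nat.mul_add_mod,
    Nat.mod_eq_of_lt hn2]
  simp only [hV]
  rw [if_neg (by rw [← ha]; omega)]

theorem card_eq (x y : ℕ → ℕ) (n : ℕ) :
    Nat.card ↥(agree x y ∩ Set.Iio n) = ∑ i ∈ Finset.range n, if x i = y i then 1 else 0 := by
  rw [← Finset.card_filter, ← Nat.card_eq_finsetCard]
  have e : agree x y ∩ Set.Iio n = ((Finset.range n).filter fun i => x i = y i : Finset ℕ) := by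
    ext i
    simp [agree, and_comm]
  rw [e]
  rfl

theorem dens_nonneg (z : Set ℕ) (n : ℕ) : (0:ℝ) ≤ (Nat.card ↥(z ∩ Set.Iio n) : ℝ) / n := by positivity

theorem dens_le_one (z : Set ℕ) (n : ℕ) : (Nat.card ↥(z ∩ Set.Iio n) : ℝ) / n ≤ 1 := by
  apply div_le_one_of_le₀ _ (Nat.cast_nonneg n)
  have : Nat.card ↥(z ∩ Set.Iio n) ≤ Nat.card ↥(Set.Iio n) :=
    Nat.card_mono (Set.finite_Iio n) Set.inter_subset_right
  simpa using this

theorem bdd_dens (z : Set ℕ) : IsBoundedUnder (· ≥ ·) atTop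
    (fun n : ℕ => (Nat.card ↥(z ∩ Set.Iio n) : ℝ) / n) :=
  ⟨0, by simpa using Eventually.of_forall (f := atTop) (dens_nonneg z)⟩

theorem cobdd_dens (z : Set ℕ) : IsCoboundedUnder (· ≥ ·) atTop
    (fun n : ℕ => (Nat.card ↥(z ∩ Set.Iio n) : ℝ) / n) :=
  IsBoundedUnder.isCoboundedUnder_ge
    ⟨1, by simpa using Eventually.of_forall (f := atTop) (dens_le_one z)⟩

theorem lowerDensity_le {z : Set ℕ} {ε : ℝ}
    (h : ∃ᶠ n : ℕ in atTop, (Nat.card ↥(z ∩ Set.Iio n) : ℝ) / n ≤ ε) : lowerDensity z ≤ ε :=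
  liminf_le_of_frequently_le h (bdd_dens z)

theorem lowerDensity_nonneg (z : Set ℕ) : 0 ≤ lowerDensity z :=
  le_liminf_of_le (cobdd_dens z) (Eventually.of_forall (dens_nonneg z))

theorem lowerDensity_le_one (z : Set ℕ) : lowerDensity z ≤ 1 :=
  lowerDensity_le (Eventually.of_forall (dens_le_one z)).frequently

theorem le_gammaVal (Y X : ℕ → ℕ) (hX : IsBitSeq X) (hc : Computable X) :
    lowerDensity (agree Y X) ≤ gammaVal Y := by
  refine le_csSup ⟨1, ?_⟩ ⟨X, ⟨hX, hc⟩, rfl⟩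
  rintro _ ⟨x, _, rfl⟩
  exact lowerDensity_le_one _

theorem gammaVal_nonneg (Y : ℕ → ℕ) : 0 ≤ gammaVal Y := by
  apply Real.sSup_nonneg
  rintro _ ⟨x, _, rfl⟩
  exact lowerDensity_nonneg _

theorem gammaVal_le (Y : ℕ → ℕ) (ε : ℝ)
    (h : ∀ X, IsBitSeq X → Computable X → lowerDensity (agree Y X) ≤ ε) : gammaVal Y ≤ ε := by
  apply csSup_le
  · exact ⟨_, fun _ => 0, ⟨fun _ => by norm_num, Computable.const 0⟩, rfl⟩
  · rintro _ ⟨x, ⟨h1, h2⟩, rfl⟩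
    exact h x h1 h2

theorem GammaVal_le (A Y : ℕ → ℕ) (hY : IsBitSeq Y) (hYA : TuringEquiv Y A) :
    GammaVal A ≤ gammaVal Y := by
  refine csInf_le ⟨0, ?_⟩ ⟨Y, ⟨hY, hYA⟩, rfl⟩
  rintro _ ⟨x, _, rfl⟩
  exact gammaVal_nonneg _

theorem GammaVal_nonneg (A : ℕ → ℕ) : 0 ≤ GammaVal A := by
  apply Real.sInf_nonneg
  rintro _ ⟨x, _, rfl⟩
  exact gammaVal_nonneg _

/-- the sequence coding `A` on powers of two and the complement of `F` elsewhere -/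
def mix (A F : ℕ → ℕ) (m : ℕ) : ℕ :=
  if m = 2 ^ Nat.log 2 m then A (Nat.log 2 m) else 1 - F m

theorem mix_pow (A F : ℕ → ℕ) (k : ℕ) : mix A F (2 ^ k) = A k := by
  simp [mix, Nat.log_pow]

theorem mix_equiv (A F : ℕ → ℕ) (hF : TuringLE F A) : TuringEquiv (mix A F) A := by
  constructor
  · have hl : Computable fun n : ℕ => Nat.log 2 n := c_log Computable.id
    have h1 : TuringLE (fun n => Nat.pair (A (Nat.log 2 n)) (F n)) A :=
      ((TuringLE.refl' A).comp' (TuringLE.of_computable A hl)).pair' hF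
    refine TuringLE.apply₂ (f := fun n => n) (u := fun n => Nat.pair (A (Nat.log 2 n)) (F n))
      (H := fun m p => if m = 2 ^ Nat.log 2 m then (Nat.unpair p).1 else 1 - (Nat.unpair p).2) ?_
      (TuringLE.of_computable A Computable.id) h1 |> fun h => ?_
    rotate_left
    · have hu : Computable fun p : ℕ × ℕ => Nat.unpair p.2 := Computable.unpair.comp Computable.snd
      exact c_ite_eq Computable.fst (c_pow (Computable.const 2) (hl.comp Computable.fst))
        (Computable.fst.comp hu) (c_sub (Computable.const 1) (Computable.snd.comp hu))
    · have e : mix A F = fun n => (fun m p => if m = 2 ^ Nat.log 2 m then (Nat.unpair p).1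
          else 1 - (Nat.unpair p).2) n (Nat.pair (A (Nat.log 2 n)) (F n)) := by
        funext n; simp [mix]
      rw [e]; exact h
  · have hp : Computable fun k : ℕ => 2 ^ k := c_pow (Computable.const 2) Computable.id
    have := (TuringLE.refl' (mix A F)).comp' (TuringLE.of_computable (mix A F) hp)
    simpa only [mix_pow] using this

theorem mix_count (A F X : ℕ → ℕ) (hF : IsBitSeq F) (w j : ℕ)
    (h : ∀ n, 2 ^ (w * j) ≤ n → n < 2 ^ (w * (j + 1)) → F n = X n) :
    (∑ i ∈ Finset.range (2 ^ (w * (j + 1))), if mix A F i = X i then 1 else 0)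
      ≤ 2 ^ (w * j) + w := by
  rw [← Finset.card_filter]
  have hsub : (Finset.range (2 ^ (w * (j + 1)))).filter (fun i => mix A F i = X i) ⊆
      Finset.range (2 ^ (w * j)) ∪ (Finset.range w).image (fun i => 2 ^ (w * j + i)) := by
    intro n hn
    rw [Finset.mem_filter, Finset.mem_range] at hn
    rw [Finset.mem_union, Finset.mem_range]
    by_cases h1 : n < 2 ^ (w * j)
    · exact Or.inl h1
    right
    push Not at h1
    have e := h n h1 hn.1
    have hn2 := hn.2
    have hb := hF n
    rw [mix] at hn2
    split_ifs at hn2 with h3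
    · have hn0 : n ≠ 0 := by
        have : 0 < 2 ^ (w * j) := by positivity
        omega
      have l1 : w * j ≤ Nat.log 2 n := by
        rw [Nat.le_log_iff_pow_le (by norm_num) hn0]; exact h1
      have l2 : Nat.log 2 n < w * (j + 1) := Nat.log_lt_of_lt_pow hn0 hn.1
      rw [Finset.mem_image]
      refine ⟨Nat.log 2 n - w * j, ?_, ?_⟩
      · rw [Nat.mul_add] at l2
        rw [Finset.mem_range]; omega
      · rw [Nat.add_sub_cancel' l1]; exact h3.symm
    · omega
  calc _ ≤ _ := Finset.card_le_card hsub
    _ ≤ _ := Finset.card_union_le _ _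
    _ ≤ 2 ^ (w * j) + w := by
      rw [Finset.card_range]
      have := Finset.card_image_le (s := Finset.range w) (f := fun i => 2 ^ (w * j + i))
      rw [Finset.card_range] at this
      omega

theorem small (A : ℕ → ℕ) (hA : IsBitSeq A) (h : GammaVal A < 1 / 2) (w : ℕ) (hw : 1 ≤ w) :
    GammaVal A ≤ (1 + w) / 2 ^ w := by
  have hne : (gammaVal '' {Y | IsBitSeq Y ∧ TuringEquiv Y A}).Nonempty :=
    ⟨_, A, ⟨hA, TuringLE.refl' A, TuringLE.refl' A⟩, rfl⟩
  obtain ⟨_, ⟨Y, ⟨hYb, hYA⟩, rfl⟩, hY⟩ := exists_lt_of_csInf_lt hne h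
  obtain ⟨c, hc1, hc2⟩ := exists_between hY
  obtain ⟨F, hFb, hFA, hF⟩ := core Y A hYb hYA.1 c hc2 (by
    intro X hXb hXc
    have h1 : lowerDensity (agree Y X) < c := (le_gammaVal Y X hXb hXc).trans_lt hc1
    have h2 := frequently_lt_of_liminf_lt (cobdd_dens _) h1
    refine (h2.and_eventually (eventually_gt_atTop 0)).mono ?_
    rintro N ⟨h3, h4⟩
    rw [card_eq, div_lt_iff₀ (by exact_mod_cast h4)] at h3
    exact h3) w hw
  have hmb : IsBitSeq (mix A F) := by
    intro n; rw [mix]; split_ifs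
    · exact hA _
    · omega
  refine (GammaVal_le A _ hmb (mix_equiv A F hFA)).trans (gammaVal_le _ _ ?_)
  intro X hXb hXc
  apply lowerDensity_le
  rw [frequently_atTop]
  intro M
  obtain ⟨j, hj1, hj2⟩ := frequently_atTop.1 (hF X hXb hXc) M
  refine ⟨2 ^ (w * (j + 1)), ?_, ?_⟩
  · have : w * (j + 1) < 2 ^ (w * (j + 1)) := Nat.lt_two_pow_self
    have : 1 * (j + 1) ≤ w * (j + 1) := Nat.mul_le_mul_right _ hw
    show M ≤ _
    omega
  · rw [card_eq]
    have := mix_count A F X hFb w j hj2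
    have h3 : ((∑ i ∈ Finset.range (2 ^ (w * (j + 1))), if mix A F i = X i then 1 else 0 : ℕ) : ℝ)
        ≤ 2 ^ (w * j) + w := by exact_mod_cast this
    have h4 : (1:ℝ) ≤ 2 ^ (w * j) := one_le_pow₀ (by norm_num)
    have h5 : (0:ℝ) ≤ w := Nat.cast_nonneg w
    push_cast at h3 ⊢
    rw [div_le_div_iff₀ (by positivity) (by positivity)]
    have e : (2:ℝ) ^ (w * (j + 1)) = 2 ^ (w * j) * 2 ^ w := by rw [← pow_add]; ring_nf
    rw [e]
    have h6 : (0:ℝ) < 2 ^ w := by positivity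
    rw [← mul_assoc]
    apply mul_le_mul_of_nonneg_right _ h6.le
    nlinarith

/-- For every infinite bit sequence `A`, if `Γ(A) < 1/2` then `Γ(A) = 0`. -/
theorem stmt2 (A : ℕ → ℕ) (hA : IsBitSeq A) (h : GammaVal A < 1 / 2) :
    GammaVal A = 0 := by
  apply le_antisymm _ (GammaVal_nonneg A)
  have t1 : Tendsto (fun w : ℕ => (1 + (w:ℝ)) / 2 ^ w) atTop (nhds 0) := by
    have a := tendsto_pow_const_div_const_pow_of_one_lt 0 (show (1:ℝ) < 2 by norm_num)
    have b := tendsto_pow_const_div_const_pow_of_one_lt 1 (show (1:ℝ) < 2 by norm_num)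
    have := a.add b
    simpa only [pow_zero, pow_one, ← add_div, add_zero] using this
  exact ge_of_tendsto t1 ((eventually_ge_atTop 1).mono fun w hw => small A hA h w hw)

end Paper
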